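/- Fix n ≥ 1 and strictly positive weights w_1,…,w_n > 0, and consider the weighted star Quantum Max Cut Hamiltonian H = Σ_{i=1}^n w_i H_{0i} on n+1 qubits with vertex set {0,1,…,n}. Then the supremum of Σ_{i=1}^n w_i · M(I, h_{0i}) over all NPA₁(Proj) moment matrices M on the n+1 sites {0,…,n} equals λ_max(H). In particular every such feasible moment matrix satisfies Σ_i w_i M(I,h_{0i}) ≤ λ_max(H), and some feasible moment matrix attains this value: the first level of the NPA hierarchy in the projector basis solves Quantum Max Cut exactly on positively weighted star graphs. -/

import Mathlib

open Matrix Finset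
open scoped ComplexOrder

noncomputable section

/-- The SWAP matrix on qubits indexed by `V`, exchanging tensor factors `i` and `j`. -/
def swapMat {V : Type*} [Fintype V] [DecidableEq V] (i j : V) :
    Matrix (V → Fin 2) (V → Fin 2) ℂ :=
  Matrix.of fun f g => if f ∘ (Equiv.swap i j) = g then 1 else 0

/-- The singlet projector `H_{ij} = (I - P_{ij})/2`. -/
def singletProj {V : Type*} [Fintype V] [DecidableEq V] (i j : V) :
    Matrix (V → Fin 2) (V → Fin 2) ℂ :=
  (2 : ℂ)⁻¹ • (1 - swapMat i j)
/-- Unordered pairs of distinct elements of `V`. -/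
def PairIdx (V : Type*) := {e : Sym2 V // ¬ e.IsDiag}

instance {V : Type*} [DecidableEq V] [Fintype V] : Fintype (PairIdx V) :=
  Subtype.fintype _

instance {V : Type*} [DecidableEq V] : DecidableEq (PairIdx V) :=
  Subtype.instDecidableEq

/-- Index set for a level-1 projector moment matrix: the symbol `I` (`none`) together with
all unordered pairs of distinct sites. -/
abbrev MIdx (V : Type*) := Option (PairIdx V)

/-- The unordered pair `{i, j}` for distinct `i ≠ j`. -/
def pr {V : Type*} (i j : V) (h : i ≠ j) : PairIdx V :=
  ⟨s(i, j), by simpa using h⟩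

/-- A (complex) `NPA₁(Proj)` moment matrix on sites `V`. -/
def IsMomentMatrix {V : Type*} [Fintype V] [DecidableEq V]
    (M : Matrix (MIdx V) (MIdx V) ℂ) : Prop :=
  M.PosSemidef ∧
  M none none = 1 ∧
  (∀ e : PairIdx V, M (some e) (some e) = M none (some e)) ∧
  (∀ e f : PairIdx V, (∀ x : V, x ∈ e.1 → x ∉ f.1) →
      M (some e) (some f) = M (some f) (some e)) ∧
  (∀ i j k : V, ∀ hij : i ≠ j, ∀ hjk : j ≠ k, ∀ hik : i ≠ k,
      M (some (pr i j hij)) (some (pr j k hjk)) +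
        M (some (pr j k hjk)) (some (pr i j hij)) =
      (M none (some (pr i j hij)) + M none (some (pr j k hjk)) -
        M none (some (pr i k hik))) / 2)

/-- The weighted star Quantum Max Cut Hamiltonian `Σ_i w_i H_{0i}` on `n+1` qubits. -/
def starHam (n : ℕ) (w : Fin n → ℝ) :
    Matrix (Fin (n+1) → Fin 2) (Fin (n+1) → Fin 2) ℂ :=
  ∑ i : Fin n, (w i : ℂ) • singletProj (0 : Fin (n+1)) i.succ

section Spectral

variable {m : Type*} [Fintype m]

open scoped MatrixOrder in
/-- The Rayleigh quotient of a Hermitian matrix is at most its largest eigenvalue. -/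
theorem Matrix.IsHermitian.re_dotProduct_mulVec_le [DecidableEq m] {A : Matrix m m ℂ}
    (hA : A.IsHermitian) (v : m → ℂ) :
    (star v ⬝ᵥ (A *ᵥ v)).re ≤ (⨆ x, hA.eigenvalues x) * (star v ⬝ᵥ v).re := by
  have hle : A ≤ algebraMap ℝ (Matrix m m ℂ) (⨆ x, hA.eigenvalues x) := by
    refine le_algebraMap_of_spectrum_le (fun x hx => ?_) hA
    rw [hA.spectrum_real_eq_range_eigenvalues] at hx
    obtain ⟨i, rfl⟩ := hx
    exact le_ciSup (Set.finite_range _).bddAbove i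
  have h := (Complex.le_def.1 ((Matrix.le_iff.1 hle).dotProduct_mulVec_nonneg v)).1
  rw [Matrix.sub_mulVec, dotProduct_sub, Algebra.algebraMap_eq_smul_one, Matrix.smul_mulVec,
    Matrix.one_mulVec, dotProduct_smul] at h
  simpa using h

/-- The largest eigenvalue of a Hermitian matrix is attained by a unit vector. -/
theorem Matrix.IsHermitian.exists_unit_mulVec_eq [DecidableEq m] [Nonempty m]
    {A : Matrix m m ℂ} (hA : A.IsHermitian) :
    ∃ v : m → ℂ, star v ⬝ᵥ v = 1 ∧ A *ᵥ v = ((⨆ x, hA.eigenvalues x : ℝ) : ℂ) • v := by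
  obtain ⟨i, hi⟩ := exists_eq_ciSup_of_finite (f := hA.eigenvalues)
  refine ⟨⇑(hA.eigenvectorBasis i), ?_, ?_⟩
  · have h := hA.eigenvectorBasis.inner_eq_one i
    rwa [EuclideanSpace.inner_eq_star_dotProduct, dotProduct_comm] at h
  · rw [hA.mulVec_eigenvectorBasis, hi, Complex.coe_smul]

/-- The real part of a positive semidefinite Hermitian form is nonnegative on real vectors. -/
theorem Matrix.PosSemidef.sum_re_nonneg {A : Matrix m m ℂ} (hA : A.PosSemidef) (y : m → ℝ) :
    0 ≤ ∑ a, ∑ b, y a * y b * (A a b).re := by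
  have h := (Complex.le_def.1 (hA.dotProduct_mulVec_nonneg fun a => (y a : ℂ))).1
  simpa [dotProduct, mulVec, Finset.mul_sum, mul_comm, mul_left_comm, mul_assoc] using h

end Spectral

section Swap

variable {V : Type*} [Fintype V] [DecidableEq V]

theorem swapMat_mulVec (i j : V) (v : (V → Fin 2) → ℂ) (f : V → Fin 2) :
    (swapMat i j *ᵥ v) f = v (f ∘ Equiv.swap i j) := by
  simp [swapMat, mulVec, dotProduct]

theorem swapMat_comm (i j : V) : swapMat i j = swapMat j i := by
  simp only [swapMat, Equiv.swap_comm]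

theorem singletProj_comm (i j : V) : singletProj i j = singletProj j i := by
  rw [singletProj, swapMat_comm, singletProj]

theorem comp_swap_comp_swap {V : Type*} [DecidableEq V] (i j : V) (f : V → Fin 2) :
    (f ∘ Equiv.swap i j) ∘ Equiv.swap i j = f := by
  rw [Function.comp_assoc, ← Equiv.coe_trans, Equiv.swap_swap, Equiv.coe_refl, Function.comp_id]

theorem swapMat_isHermitian (i j : V) : (swapMat i j).IsHermitian := by
  ext f g
  have h : g ∘ Equiv.swap i j = f ↔ f ∘ Equiv.swap i j = g :=
    ⟨fun h => by rw [← h, comp_swap_comp_swap], fun h => by rw [← h, comp_swap_comp_swap]⟩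
  simp [swapMat, conjTranspose_apply, h]

theorem swapMat_mul_self (i j : V) : swapMat i j * swapMat i j = 1 := by
  refine Matrix.mulVec_injective (funext fun v => funext fun f => ?_)
  rw [← mulVec_mulVec, swapMat_mulVec, swapMat_mulVec, comp_swap_comp_swap, one_mulVec]

theorem swapMat_mul_comm {i j k l : V} (hik : i ≠ k) (hil : i ≠ l) (hjk : j ≠ k) (hjl : j ≠ l) :
    swapMat i j * swapMat k l = swapMat k l * swapMat i j := by
  refine Matrix.mulVec_injective (funext fun v => funext fun f => ?_)
  simp only [← mulVec_mulVec, swapMat_mulVec]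
  congr 1
  ext x
  simp only [Function.comp_apply, Equiv.swap_apply_def]
  grind

/-- The antisymmetrizer of three qubits vanishes. -/
theorem swapMat_mul_add_mul {i j k : V} (hij : i ≠ j) (hjk : j ≠ k) (hik : i ≠ k) :
    swapMat i j * swapMat j k + swapMat j k * swapMat i j =
      swapMat i j + swapMat j k + swapMat i k - 1 := by
  refine Matrix.mulVec_injective (funext fun v => funext fun f => ?_)
  simp only [add_mulVec, sub_mulVec, Pi.add_apply, Pi.sub_apply, one_mulVec, ← mulVec_mulVec,
    swapMat_mulVec]
  have hcases : f i = f j ∨ f j = f k ∨ f i = f k := by omega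
  rcases hcases with h | h | h
  · have h1 : f ∘ Equiv.swap i j = f := by ext x; simp [Equiv.swap_apply_def]; grind
    have h2 : (f ∘ Equiv.swap j k) ∘ Equiv.swap i j = f ∘ Equiv.swap i k := by
      ext x; simp [Equiv.swap_apply_def]; grind
    rw [h2, h1]; ring
  · have h1 : f ∘ Equiv.swap j k = f := by ext x; simp [Equiv.swap_apply_def]; grind
    have h2 : (f ∘ Equiv.swap i j) ∘ Equiv.swap j k = f ∘ Equiv.swap i k := by
      ext x; simp [Equiv.swap_apply_def]; grind
    rw [h2, h1]; ring
  · have h1 : f ∘ Equiv.swap i k = f := by ext x; simp [Equiv.swap_apply_def]; grind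
    have h2 : (f ∘ Equiv.swap i j) ∘ Equiv.swap j k = f ∘ Equiv.swap i j := by
      ext x; simp [Equiv.swap_apply_def]; grind
    have h3 : (f ∘ Equiv.swap j k) ∘ Equiv.swap i j = f ∘ Equiv.swap j k := by
      ext x; simp [Equiv.swap_apply_def]; grind
    rw [h2, h3, h1]; ring

theorem singletProj_isHermitian (i j : V) : (singletProj i j).IsHermitian := by
  rw [IsHermitian, singletProj, conjTranspose_smul, conjTranspose_sub, conjTranspose_one,
    (swapMat_isHermitian i j).eq]
  simp

theorem singletProj_mul_self (i j : V) :
    singletProj i j * singletProj i j = singletProj i j := by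
  simp only [singletProj, smul_mul_smul_comm, sub_mul, mul_sub, swapMat_mul_self, one_mul, mul_one]
  module

theorem singletProj_mul_comm {i j k l : V} (hik : i ≠ k) (hil : i ≠ l) (hjk : j ≠ k)
    (hjl : j ≠ l) : singletProj i j * singletProj k l = singletProj k l * singletProj i j := by
  simp only [singletProj, smul_mul_smul_comm, sub_mul, mul_sub, one_mul, mul_one,
    swapMat_mul_comm hik hil hjk hjl]
  module

theorem singletProj_mul_add_mul {i j k : V} (hij : i ≠ j) (hjk : j ≠ k) (hik : i ≠ k) :
    singletProj i j * singletProj j k + singletProj j k * singletProj i j =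
      (2 : ℂ)⁻¹ • (singletProj i j + singletProj j k - singletProj i k) := by
  have h := eq_sub_of_add_eq (swapMat_mul_add_mul hij hjk hik)
  simp only [singletProj, smul_mul_smul_comm, sub_mul, mul_sub, one_mul, mul_one, h]
  module

end Swap

section MomentOfState

variable {V : Type*} [Fintype V] [DecidableEq V]

/-- The operator attached to an index of a level-1 projector moment matrix. -/
def idxOp : MIdx V → Matrix (V → Fin 2) (V → Fin 2) ℂ
  | none => 1
  | some e => Sym2.lift ⟨singletProj, singletProj_comm⟩ e.1

@[simp]
theorem idxOp_none : idxOp (none : MIdx V) = 1 := rfl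

@[simp]
theorem idxOp_pr (i j : V) (h : i ≠ j) : idxOp (some (pr i j h)) = singletProj i j := rfl

theorem PairIdx.exists_eq_pr {V : Type*} (e : PairIdx V) : ∃ i j h, e = pr i j h := by
  obtain ⟨e, he⟩ := e
  induction e with
  | _ i j => exact ⟨i, j, by simpa using he, rfl⟩

theorem idxOp_isHermitian (a : MIdx V) : (idxOp a).IsHermitian := by
  rcases a with _ | e
  · exact isHermitian_one
  · obtain ⟨i, j, h, rfl⟩ := e.exists_eq_pr
    exact singletProj_isHermitian i j

/-- The moment matrix of the (unnormalized) pure state `v`. -/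
def stateMoment (v : (V → Fin 2) → ℂ) : Matrix (MIdx V) (MIdx V) ℂ :=
  Matrix.of fun a b => star v ⬝ᵥ ((idxOp a * idxOp b) *ᵥ v)

theorem stateMoment_posSemidef (v : (V → Fin 2) → ℂ) : (stateMoment v).PosSemidef := by
  have h : stateMoment v =
      (Matrix.of fun f a => (idxOp a *ᵥ v) f)ᴴ * Matrix.of fun f (a : MIdx V) => (idxOp a *ᵥ v) f := by
    ext a b
    have hab : stateMoment v a b = star (idxOp a *ᵥ v) ⬝ᵥ (idxOp b *ᵥ v) := by
      rw [star_mulVec, (idxOp_isHermitian a).eq, ← dotProduct_mulVec, mulVec_mulVec]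
      rfl
    rw [hab]
    rfl
  rw [h]
  exact posSemidef_conjTranspose_mul_self _

theorem stateMoment_isMomentMatrix {v : (V → Fin 2) → ℂ} (hv : star v ⬝ᵥ v = 1) :
    IsMomentMatrix (stateMoment v) := by
  refine ⟨stateMoment_posSemidef v, by simp [stateMoment, hv], fun e => ?_, fun e f hef => ?_,
    fun i j k hij hjk hik => ?_⟩
  · obtain ⟨i, j, h, rfl⟩ := e.exists_eq_pr
    simp [stateMoment, singletProj_mul_self]
  · obtain ⟨i, j, h, rfl⟩ := e.exists_eq_pr
    obtain ⟨k, l, h', rfl⟩ := f.exists_eq_pr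
    have hi := hef i (by simp [pr])
    have hj := hef j (by simp [pr])
    simp only [pr, Sym2.mem_iff, not_or] at hi hj
    simp only [stateMoment, of_apply, idxOp_pr, singletProj_mul_comm hi.1 hi.2 hj.1 hj.2]
  · simp only [stateMoment, of_apply, idxOp_pr, idxOp_none, one_mul]
    rw [← dotProduct_add, ← add_mulVec, singletProj_mul_add_mul hij hjk hik, smul_mulVec,
      sub_mulVec, add_mulVec, dotProduct_smul, dotProduct_sub, dotProduct_add, smul_eq_mul]
    ring

end MomentOfState

section OneMagnon

variable {V : Type*} [DecidableEq V]

/-- The state with one excitation, of amplitude `x k` at site `k`. -/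
def magnon (x : V → ℝ) : (V → Fin 2) → ℂ :=
  Function.extend (fun k : V => (Pi.single k 1 : V → Fin 2)) (fun k => (x k : ℂ)) 0

theorem single_one_injective :
    Function.Injective fun k : V => (Pi.single k 1 : V → Fin 2) := fun k l h => by
  by_contra hkl
  simpa [Pi.single_apply, hkl] using congrFun h k

theorem magnon_single (x : V → ℝ) (k : V) : magnon x (Pi.single k 1) = x k :=
  single_one_injective.extend_apply _ _ k

theorem star_magnon_dotProduct [Fintype V] (x : V → ℝ)
    (u : (V → Fin 2) → ℂ) :
    star (magnon x) ⬝ᵥ u = ∑ k, (x k : ℂ) * u (Pi.single k 1) := by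
  rw [dotProduct]
  refine (Fintype.sum_of_injective _ single_one_injective _ _ (fun f hf => ?_) fun k => ?_).symm
  · simp [magnon, Function.extend_apply' _ _ f (by simpa using hf)]
  · simp [magnon_single]

theorem single_comp_swap (i j k : V) :
    (Pi.single k 1 : V → Fin 2) ∘ Equiv.swap i j = Pi.single (Equiv.swap i j k) 1 := by
  ext y
  simp only [Function.comp_apply, Pi.single_apply, Equiv.swap_apply_eq_iff]

theorem sum_mul_sub_swap [Fintype V] {i j : V} (hij : i ≠ j) (x : V → ℝ) :
    ∑ k, x k * (x k - x (Equiv.swap i j k)) = (x i - x j) ^ 2 := by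
  rw [Fintype.sum_eq_add i j hij fun k hk => by simp [Equiv.swap_apply_of_ne_of_ne hk.1 hk.2],
    Equiv.swap_apply_left, Equiv.swap_apply_right]
  ring

/-- On one-magnon states the singlet projector acts as half an edge Laplacian. -/
theorem star_magnon_dotProduct_singletProj [Fintype V] {i j : V} (hij : i ≠ j) (x : V → ℝ) :
    star (magnon x) ⬝ᵥ (singletProj i j *ᵥ magnon x) = (((x i - x j) ^ 2 / 2 : ℝ) : ℂ) := by
  rw [star_magnon_dotProduct, ← sum_mul_sub_swap hij]
  push_cast
  rw [Finset.sum_div]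
  refine Finset.sum_congr rfl fun k _ => ?_
  rw [singletProj, smul_mulVec, sub_mulVec, one_mulVec, Pi.smul_apply, Pi.sub_apply,
    swapMat_mulVec, single_comp_swap, magnon_single, magnon_single, smul_eq_mul]
  ring

end OneMagnon

theorem starHam_form (n : ℕ) (w : Fin n → ℝ) (v : (Fin (n + 1) → Fin 2) → ℂ) :
    star v ⬝ᵥ (starHam n w *ᵥ v) =
      ∑ i, (w i : ℂ) * (star v ⬝ᵥ (singletProj 0 i.succ *ᵥ v)) := by
  simp only [starHam, sum_mulVec, dotProduct_sum, smul_mulVec, dotProduct_smul, smul_eq_mul]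

/-- The largest eigenvalue of the star Hamiltonian dominates half the weighted star Laplacian. -/
theorem sum_mul_sq_le_iSup_eigenvalues {n : ℕ} {w : Fin n → ℝ} (hH : (starHam n w).IsHermitian)
    (x : Fin (n + 1) → ℝ) :
    (∑ i, w i * (x 0 - x i.succ) ^ 2) / 2 ≤ (⨆ y, hH.eigenvalues y) * ∑ k, x k ^ 2 := by
  have h := hH.re_dotProduct_mulVec_le (magnon x)
  have h1 : star (magnon x) ⬝ᵥ magnon x = ((∑ k, x k ^ 2 : ℝ) : ℂ) := by
    rw [star_magnon_dotProduct]
    simp [magnon_single, sq]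
  have h2 : star (magnon x) ⬝ᵥ (starHam n w *ᵥ magnon x) =
      (((∑ i, w i * (x 0 - x i.succ) ^ 2) / 2 : ℝ) : ℂ) := by
    rw [starHam_form, Finset.sum_div]
    push_cast
    refine Finset.sum_congr rfl fun i _ => ?_
    rw [star_magnon_dotProduct_singletProj (Fin.succ_ne_zero i).symm]
    push_cast
    ring
  rwa [h1, h2, Complex.ofReal_re, Complex.ofReal_re] at h

theorem iSup_eigenvalues_starHam_nonneg {n : ℕ} {w : Fin n → ℝ}
    (hH : (starHam n w).IsHermitian) : 0 ≤ ⨆ y, hH.eigenvalues y := by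
  have h := sum_mul_sq_le_iSup_eigenvalues hH fun _ => 1
  simp only [sub_self, one_pow, ne_eq, OfNat.ofNat_ne_zero, not_false_eq_true, zero_pow, mul_zero,
    Finset.sum_const_zero, zero_div, Finset.sum_const, Finset.card_univ, Fintype.card_fin,
    nsmul_eq_mul, mul_one] at h
  exact nonneg_of_mul_nonneg_left h (by positivity)

/-- The quadratic form of the edge Gram matrix of the star is controlled by the largest eigenvalue
of the star Hamiltonian. -/
theorem sq_sum_add_sum_sq_le {n : ℕ} {w : Fin n → ℝ} (hw : ∀ i, 0 ≤ w i)
    (hH : (starHam n w).IsHermitian) (r : Fin n → ℝ) :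
    (∑ i, w i * r i) ^ 2 + ∑ i, (w i * r i) ^ 2 ≤
      2 * (⨆ y, hH.eigenvalues y) * ∑ i, w i * r i ^ 2 := by
  set μ := ⨆ y, hH.eigenvalues y
  set S := ∑ i, w i * r i with hS
  set N := S ^ 2 + ∑ i, (w i * r i) ^ 2 with hN
  set X := ∑ i, w i * r i ^ 2 with hX
  have hray := sum_mul_sq_le_iSup_eigenvalues hH (Fin.cons S fun i => -(w i * r i))
  simp only [Fin.sum_univ_succ, Fin.cons_zero, Fin.cons_succ, neg_sq, sub_neg_eq_add] at hray
  rw [← hN] at hray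
  have hcs := Finset.sum_mul_sq_le_sq_mul_sq Finset.univ (fun i => √(w i) * r i)
    fun i => √(w i) * (S + w i * r i)
  have h1 : ∑ i, √(w i) * r i * (√(w i) * (S + w i * r i)) = N := by
    rw [hN, sq S]
    nth_rewrite 2 [hS]
    rw [Finset.sum_mul, ← Finset.sum_add_distrib]
    refine Finset.sum_congr rfl fun i _ => ?_
    have := Real.mul_self_sqrt (hw i)
    linear_combination (r i * (S + w i * r i)) * this
  simp only [h1, mul_pow, Real.sq_sqrt (hw _)] at hcs
  rw [← hX] at hcs
  have hX0 : 0 ≤ X := Finset.sum_nonneg fun i _ => mul_nonneg (hw i) (sq_nonneg _)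
  have hN0 : 0 ≤ N := add_nonneg (sq_nonneg _) (Finset.sum_nonneg fun i _ => sq_nonneg _)
  have hkey : N ^ 2 ≤ X * (2 * (μ * N)) := hcs.trans (mul_le_mul_of_nonneg_left (by linarith) hX0)
  rcases hN0.eq_or_lt with h0 | hpos
  · rw [← h0]
    exact mul_nonneg (mul_nonneg zero_le_two (iSup_eigenvalues_starHam_nonneg hH)) hX0
  · refine le_of_mul_le_mul_right ?_ hpos
    linarith

/-- Vectors of squared lengths `a`, `b`, `c` with the inner products of three singlet projectors
have lengths obeying the triangle inequality. -/
theorem le_add_of_gram_nonneg {r s t : ℝ} (hr : 0 ≤ r) (hs : 0 ≤ s) (ht : 0 ≤ t)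
    (h : ∀ α β γ : ℝ, 0 ≤ α ^ 2 * r ^ 2 + β ^ 2 * s ^ 2 + γ ^ 2 * t ^ 2
      + α * β * (r ^ 2 + s ^ 2 - t ^ 2) / 2 + β * γ * (s ^ 2 + t ^ 2 - r ^ 2) / 2
      + α * γ * (r ^ 2 + t ^ 2 - s ^ 2) / 2) : r ≤ s + t := by
  by_contra! hlt
  rcases hs.eq_or_lt with rfl | hs'
  · have hd : 0 < r ^ 2 - t ^ 2 := by nlinarith
    have := h 1 (-2 * (r ^ 2 + 1) / (r ^ 2 - t ^ 2)) 0
    field_simp at this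
    nlinarith
  rcases ht.eq_or_lt with rfl | ht'
  · have hd : 0 < r ^ 2 - s ^ 2 := by nlinarith
    have := h 1 0 (-2 * (r ^ 2 + 1) / (r ^ 2 - s ^ 2))
    field_simp at this
    nlinarith
  have hr' : 0 < r := by linarith
  have hpos : 0 < (r - s - t) * (r ^ 2 + 2 * (s + t) * r + (s - t) ^ 2) * (r * s * t) := by
    have : 0 < r - s - t := by linarith
    positivity
  have := h (s * t) (-(r * t)) (-(r * s))
  linarith

/-- Singlet triples: the Gram bound in terms of square roots of the moments. -/
theorem add_sub_le_of_gram_nonneg {a b c : ℝ} (ha : 0 ≤ a) (hb : 0 ≤ b) (hc : 0 ≤ c)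
    (h : ∀ α β γ : ℝ, 0 ≤ α ^ 2 * a + β ^ 2 * b + γ ^ 2 * c
      + α * β * (a + b - c) / 2 + β * γ * (b + c - a) / 2
      + α * γ * (a + c - b) / 2) : a + b - c ≤ 2 * (√a * √b) := by
  have h1 := le_add_of_gram_nonneg (Real.sqrt_nonneg a) (Real.sqrt_nonneg b) (Real.sqrt_nonneg c)
    (by simpa only [Real.sq_sqrt, ha, hb, hc] using h)
  have h2 := le_add_of_gram_nonneg (Real.sqrt_nonneg b) (Real.sqrt_nonneg a) (Real.sqrt_nonneg c)
    (by
      simp only [Real.sq_sqrt, ha, hb, hc]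
      intro α β γ
      linarith [h β α γ])
  have h3 : (√a - √b) ^ 2 ≤ √c ^ 2 :=
    sq_le_sq' (by linarith) (by linarith)
  rw [Real.sq_sqrt hc, sub_sq, Real.sq_sqrt ha, Real.sq_sqrt hb] at h3
  linarith

section Moments

variable {V : Type*} [Fintype V] [DecidableEq V] {M : Matrix (MIdx V) (MIdx V) ℂ}

theorem pr_comm {V : Type*} (i j : V) (h : i ≠ j) : pr i j h = pr j i h.symm :=
  Subtype.ext Sym2.eq_swap

theorem Matrix.IsHermitian.re_apply_comm {m : Type*} {A : Matrix m m ℂ} (hA : A.IsHermitian)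
    (a b : m) : (A a b).re = (A b a).re := by
  rw [← hA.apply b a, Complex.star_def, Complex.conj_re]

theorem IsMomentMatrix.re_diag (hM : IsMomentMatrix M) (e : PairIdx V) :
    (M (some e) (some e)).re = (M none (some e)).re :=
  congrArg Complex.re (hM.2.2.1 e)

theorem IsMomentMatrix.re_nonneg (hM : IsMomentMatrix M) (e : PairIdx V) :
    0 ≤ (M none (some e)).re := by
  rw [← hM.re_diag]
  exact (Complex.le_def.1 hM.1.diag_nonneg).1

theorem IsMomentMatrix.re_adjacent (hM : IsMomentMatrix M) {i j k : V} (hij : i ≠ j) (hjk : j ≠ k)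
    (hik : i ≠ k) :
    (M (some (pr i j hij)) (some (pr j k hjk))).re =
      ((M none (some (pr i j hij))).re + (M none (some (pr j k hjk))).re -
        (M none (some (pr i k hik))).re) / 4 := by
  have h := congrArg Complex.re (hM.2.2.2.2 i j k hij hjk hik)
  rw [Complex.add_re, hM.1.isHermitian.re_apply_comm (some (pr j k hjk)), Complex.div_ofNat_re,
    Complex.sub_re, Complex.add_re] at h
  linarith

/-- Overlap bound for two edges sharing the vertex `o`. -/
theorem IsMomentMatrix.re_adjacent_le (hM : IsMomentMatrix M) {o i j : V} (hi : o ≠ i) (hj : o ≠ j)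
    (hij : i ≠ j) :
    (M (some (pr o i hi)) (some (pr o j hj))).re ≤
      √(M none (some (pr o i hi))).re * √(M none (some (pr o j hj))).re / 2 := by
  have h1 := hM.re_adjacent hi.symm hj hij
  have h2 := hM.re_adjacent hi hij hj
  have h3 := hM.re_adjacent hj hij.symm hi
  rw [pr_comm i o] at h1
  rw [pr_comm j i] at h3
  have h := add_sub_le_of_gram_nonneg (hM.re_nonneg (pr o i hi)) (hM.re_nonneg (pr o j hj))
    (hM.re_nonneg (pr i j hij)) fun α β γ => by
      have hpsd := (hM.1.submatrix ![some (pr o i hi), some (pr o j hj),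
        some (pr i j hij)]).sum_re_nonneg ![α, β, γ]
      have hcomm := hM.1.isHermitian.re_apply_comm
      simp only [Fin.sum_univ_three, submatrix_apply, Matrix.cons_val] at hpsd
      rw [hM.re_diag, hM.re_diag, hM.re_diag, hcomm (some (pr o j hj)) (some (pr o i hi)),
        hcomm (some (pr i j hij)) (some (pr o i hi)), hcomm (some (pr i j hij)) (some (pr o j hj)),
        h1, h2, h3] at hpsd
      linarith
  linarith

end Moments

/-- The star value of a moment matrix is at most the largest eigenvalue. -/
theorem IsMomentMatrix.star_value_le {n : ℕ} {w : Fin n → ℝ} (hw : ∀ i, 0 ≤ w i)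
    (hH : (starHam n w).IsHermitian) {M : Matrix (MIdx (Fin (n + 1))) (MIdx (Fin (n + 1))) ℂ}
    (hM : IsMomentMatrix M) :
    ∑ i : Fin n, w i * (M none (some (pr 0 i.succ (Fin.succ_ne_zero i).symm))).re ≤
      ⨆ x, hH.eigenvalues x := by
  set μ := ⨆ x, hH.eigenvalues x with hμ
  let e : Fin n → MIdx (Fin (n + 1)) := fun i => some (pr 0 i.succ (Fin.succ_ne_zero i).symm)
  set X := ∑ i, w i * (M none (e i)).re with hX
  have hm : ∀ i, 0 ≤ (M none (e i)).re := fun i => hM.re_nonneg _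
  let r : Fin n → ℝ := fun i => √(M none (e i)).re
  have hr : ∀ i, r i ^ 2 = (M none (e i)).re := fun i => Real.sq_sqrt (hm i)
  have hentry : ∀ i j, (M (e i) (e j)).re ≤ (r i * r j + if i = j then r i ^ 2 else 0) / 2 := by
    intro i j
    split_ifs with hij
    · subst hij
      rw [hM.re_diag, ← sq, hr]
      linarith
    · rw [add_zero]
      exact hM.re_adjacent_le _ _ fun h => hij (Fin.succ_injective _ h)
  have hgram : ∑ i, ∑ j, w i * w j * (M (e i) (e j)).re ≤
      ((∑ i, w i * r i) ^ 2 + ∑ i, (w i * r i) ^ 2) / 2 := by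
    calc _ ≤ ∑ i, ∑ j, w i * w j * ((r i * r j + if i = j then r i ^ 2 else 0) / 2) :=
          Finset.sum_le_sum fun i _ => Finset.sum_le_sum fun j _ =>
            mul_le_mul_of_nonneg_left (hentry i j) (mul_nonneg (hw i) (hw j))
      _ = _ := by
          rw [sq, Finset.sum_mul_sum, ← Finset.sum_add_distrib, Finset.sum_div]
          refine Finset.sum_congr rfl fun i _ => ?_
          have hdiag : (w i * r i) ^ 2 = ∑ j, if i = j then w i * w j * r i ^ 2 else 0 := by
            rw [Finset.sum_ite_eq, if_pos (Finset.mem_univ i)]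
            ring
          rw [hdiag, ← Finset.sum_add_distrib, Finset.sum_div]
          refine Finset.sum_congr rfl fun j _ => ?_
          split_ifs <;> ring
  have hspec := sq_sum_add_sum_sq_le hw hH r
  simp only [hr] at hspec
  rw [← hX, ← hμ] at hspec
  have hpsd := (hM.1.submatrix fun o : Option (Fin n) => o.elim none e).sum_re_nonneg
    fun o => o.elim X fun i => -w i
  simp only [Fintype.sum_option, submatrix_apply, Option.elim_none, Option.elim_some, hM.2.1,
    Complex.one_re, hM.1.isHermitian.re_apply_comm (e _) none, neg_mul_neg,
    Finset.sum_add_distrib] at hpsd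
  have hcross1 : ∑ i, X * -w i * (M none (e i)).re = -(X * X) := by
    nth_rewrite 3 [hX]
    rw [Finset.mul_sum, ← Finset.sum_neg_distrib]
    exact Finset.sum_congr rfl fun i _ => by ring
  have hcross2 : ∑ i, -w i * X * (M none (e i)).re = -(X * X) := by
    rw [← hcross1]
    exact Finset.sum_congr rfl fun i _ => by ring
  rw [hcross1, hcross2] at hpsd
  have hX0 : 0 ≤ X := Finset.sum_nonneg fun i _ => mul_nonneg (hw i) (hm i)
  rcases hX0.eq_or_lt with h0 | hpos
  · exact h0.symm.le.trans (iSup_eigenvalues_starHam_nonneg hH)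
  · refine le_of_mul_le_mul_right ?_ hpos
    linarith

/-- A top eigenvector of the star Hamiltonian gives a moment matrix attaining the bound. -/
theorem exists_isMomentMatrix_star_value_eq {n : ℕ} {w : Fin n → ℝ}
    (hH : (starHam n w).IsHermitian) :
    ∃ M : Matrix (MIdx (Fin (n + 1))) (MIdx (Fin (n + 1))) ℂ, IsMomentMatrix M ∧
      ∑ i : Fin n, w i * (M none (some (pr 0 i.succ (Fin.succ_ne_zero i).symm))).re =
        ⨆ x, hH.eigenvalues x := by
  obtain ⟨v, hv, heig⟩ := hH.exists_unit_mulVec_eq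
  refine ⟨stateMoment v, stateMoment_isMomentMatrix hv, ?_⟩
  have h := congrArg Complex.re (starHam_form n w v)
  rw [heig, dotProduct_smul, hv, smul_eq_mul, mul_one, Complex.ofReal_re, Complex.re_sum] at h
  simp only [Complex.re_ofReal_mul] at h
  simpa [stateMoment] using h.symm

/-- The first level of the NPA hierarchy in the projector basis solves Quantum Max Cut
exactly on positively weighted star graphs. -/
theorem stmt6 (n : ℕ) (hn : 1 ≤ n) (w : Fin n → ℝ) (hw : ∀ i, 0 < w i)
    (hH : (starHam n w).IsHermitian) :
    (∀ M : Matrix (MIdx (Fin (n+1))) (MIdx (Fin (n+1))) ℂ, IsMomentMatrix M →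
      ∑ i : Fin n,
          w i * (M none (some (pr (0 : Fin (n+1)) i.succ (Fin.succ_ne_zero i).symm))).re
        ≤ ⨆ x, hH.eigenvalues x) ∧
    (∃ M : Matrix (MIdx (Fin (n+1))) (MIdx (Fin (n+1))) ℂ, IsMomentMatrix M ∧
      ∑ i : Fin n,
          w i * (M none (some (pr (0 : Fin (n+1)) i.succ (Fin.succ_ne_zero i).symm))).re
        = ⨆ x, hH.eigenvalues x) ∧
    sSup {v : ℝ | ∃ M : Matrix (MIdx (Fin (n+1))) (MIdx (Fin (n+1))) ℂ,
        IsMomentMatrix M ∧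
        v = ∑ i : Fin n,
          w i * (M none (some (pr (0 : Fin (n+1)) i.succ (Fin.succ_ne_zero i).symm))).re}
      = ⨆ x, hH.eigenvalues x := by
  have hle := fun M (hM : IsMomentMatrix M) => hM.star_value_le (fun i => (hw i).le) hH
  obtain ⟨M, hM, hval⟩ := exists_isMomentMatrix_star_value_eq hH
  refine ⟨hle, ⟨M, hM, hval⟩, IsGreatest.csSup_eq ⟨⟨M, hM, hval.symm⟩, ?_⟩⟩
  rintro _ ⟨N, hN, rfl⟩
  exact hle N hN

end
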